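/- Let k be a field of characteristic zero and let A and B be commutative k-algebras. If ML(A) = k (the image of k in A) and ML(B) = k, then ML(A ⊗_k B) = k (the image of k in A ⊗_k B). -/

import Mathlib

/-- A derivation `D` is locally nilpotent if for every `a` some positive iterate of `D`
kills `a`. -/
def Derivation.IsLocallyNilpotent {k A : Type*} [CommRing k] [CommRing A] [Algebra k A]
    (D : Derivation k A A) : Prop :=
  ∀ a : A, ∃ n : ℕ, 0 < n ∧ (⇑D)^[n] a = 0

/-- The kernel of a derivation `D : A → A`, as a `k`-subalgebra of `A`. -/
def Derivation.kerSubalgebra {k A : Type*} [CommRing k] [CommRing A] [Algebra k A]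
    (D : Derivation k A A) : Subalgebra k A where
  carrier := {a : A | D a = 0}
  add_mem' := by
    intro a b ha hb
    simp only [Set.mem_setOf_eq] at *
    rw [map_add, ha, hb, add_zero]
  mul_mem' := by
    intro a b ha hb
    simp only [Set.mem_setOf_eq] at *
    rw [Derivation.leibniz, ha, hb, smul_zero, smul_zero, add_zero]
  algebraMap_mem' := fun r => by
    simp only [Set.mem_setOf_eq, Derivation.map_algebraMap]

/-- The Makar-Limanov invariant of a commutative `k`-algebra `A`: the intersection of the
kernels of all locally nilpotent `k`-derivations of `A`. -/
def MakarLimanov (k A : Type*) [CommRing k] [CommRing A] [Algebra k A] : Subalgebra k A :=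
  ⨅ D : {D : Derivation k A A // D.IsLocallyNilpotent}, (D : Derivation k A A).kerSubalgebra

section

open TensorProduct

variable {k A B : Type*} [CommRing k] [CommRing A] [Algebra k A] [CommRing B] [Algebra k B]

theorem mem_makarLimanov_iff {a : A} :
    a ∈ MakarLimanov k A ↔ ∀ D : Derivation k A A, D.IsLocallyNilpotent → D a = 0 := by
  simp only [MakarLimanov, Algebra.mem_iInf, Subtype.forall]
  rfl

/-- The derivation `D ⊗ id` of `A ⊗[k] B` extending a derivation `D` of `A`. -/
noncomputable def Derivation.rTensor (B : Type*) [CommRing B] [Algebra k B]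
    (D : Derivation k A A) : Derivation k (A ⊗[k] B) (A ⊗[k] B) :=
  Derivation.mk' (LinearMap.rTensor B (D : A →ₗ[k] A)) fun x y => by
    induction x with
    | zero => simp
    | add x₁ x₂ h₁ h₂ =>
      simp only [add_mul, add_smul, smul_add, map_add, h₁, h₂]
      abel
    | tmul a b =>
      induction y with
      | zero => simp
      | add y₁ y₂ h₁ h₂ =>
        simp only [mul_add, add_smul, smul_add, map_add, h₁, h₂]
        abel
      | tmul a' b' => simp [TensorProduct.add_tmul, mul_comm]

/-- The derivation `id ⊗ D` of `A ⊗[k] B` extending a derivation `D` of `B`. -/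
noncomputable def Derivation.lTensor (A : Type*) [CommRing A] [Algebra k A]
    (D : Derivation k B B) : Derivation k (A ⊗[k] B) (A ⊗[k] B) :=
  Derivation.mk' (LinearMap.lTensor A (D : B →ₗ[k] B)) fun x y => by
    induction x with
    | zero => simp
    | add x₁ x₂ h₁ h₂ =>
      simp only [add_mul, add_smul, smul_add, map_add, h₁, h₂]
      abel
    | tmul a b =>
      induction y with
      | zero => simp
      | add y₁ y₂ h₁ h₂ =>
        simp only [mul_add, add_smul, smul_add, map_add, h₁, h₂]
        abel
      | tmul a' b' => simp [TensorProduct.tmul_add, mul_comm]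

@[simp]
theorem Derivation.rTensor_tmul (D : Derivation k A A) (a : A) (b : B) :
    D.rTensor B (a ⊗ₜ[k] b) = D a ⊗ₜ b := rfl

@[simp]
theorem Derivation.lTensor_tmul (D : Derivation k B B) (a : A) (b : B) :
    D.lTensor A (a ⊗ₜ[k] b) = a ⊗ₜ D b := rfl

theorem Derivation.iterate_rTensor_tmul (D : Derivation k A A) (n : ℕ) (a : A) (b : B) :
    (⇑(D.rTensor B))^[n] (a ⊗ₜ[k] b) = (⇑D)^[n] a ⊗ₜ b := by
  induction n with
  | zero => rfl
  | succ n ih => simp only [Function.iterate_succ_apply', ih, rTensor_tmul]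

theorem Derivation.iterate_lTensor_tmul (D : Derivation k B B) (n : ℕ) (a : A) (b : B) :
    (⇑(D.lTensor A))^[n] (a ⊗ₜ[k] b) = a ⊗ₜ (⇑D)^[n] b := by
  induction n with
  | zero => rfl
  | succ n ih => simp only [Function.iterate_succ_apply', ih, lTensor_tmul]

theorem Derivation.exists_iterate_add_eq_zero (D : Derivation k A A) {x y : A}
    (hx : ∃ n : ℕ, 0 < n ∧ (⇑D)^[n] x = 0) (hy : ∃ n : ℕ, 0 < n ∧ (⇑D)^[n] y = 0) :
    ∃ n : ℕ, 0 < n ∧ (⇑D)^[n] (x + y) = 0 := by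
  obtain ⟨n, hn, hx⟩ := hx
  obtain ⟨m, -, hy⟩ := hy
  refine ⟨n + m, by omega, ?_⟩
  rw [iterate_map_add, Function.iterate_add_apply (⇑D) n m y, hy, add_comm n m,
    Function.iterate_add_apply, hx, iterate_map_zero, iterate_map_zero, add_zero]

theorem Derivation.IsLocallyNilpotent.rTensor {D : Derivation k A A}
    (hD : D.IsLocallyNilpotent) : (D.rTensor B).IsLocallyNilpotent := fun x => by
  induction x with
  | zero => exact ⟨1, one_pos, map_zero _⟩
  | add x y hx hy => exact Derivation.exists_iterate_add_eq_zero _ hx hy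
  | tmul a b =>
    obtain ⟨n, hn, h⟩ := hD a
    exact ⟨n, hn, by rw [Derivation.iterate_rTensor_tmul, h, TensorProduct.zero_tmul]⟩

theorem Derivation.IsLocallyNilpotent.lTensor {D : Derivation k B B}
    (hD : D.IsLocallyNilpotent) : (D.lTensor A).IsLocallyNilpotent := fun x => by
  induction x with
  | zero => exact ⟨1, one_pos, map_zero _⟩
  | add x y hx hy => exact Derivation.exists_iterate_add_eq_zero _ hx hy
  | tmul a b =>
    obtain ⟨n, hn, h⟩ := hD b
    exact ⟨n, hn, by rw [Derivation.iterate_lTensor_tmul, h, TensorProduct.tmul_zero]⟩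

theorem Derivation.basis_repr_rTensor {ι : Type*} (b : Module.Basis ι k B)
    (D : Derivation k A A) (x : A ⊗[k] B) (i : ι) :
    (Algebra.TensorProduct.basis A b).repr (D.rTensor B x) i =
      D ((Algebra.TensorProduct.basis A b).repr x i) := by
  induction x with
  | zero => simp
  | add x y hx hy => simp only [map_add, Finsupp.add_apply, hx, hy]
  | tmul a c => simp [Algebra.TensorProduct.basis_repr_tmul, ← Algebra.commutes, ← Algebra.smul_def]

theorem basis_repr_mem_makarLimanov {ι : Type*} (b : Module.Basis ι k B) {x : A ⊗[k] B}
    (hx : x ∈ MakarLimanov k (A ⊗[k] B)) (i : ι) :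
    (Algebra.TensorProduct.basis A b).repr x i ∈ MakarLimanov k A := by
  rw [mem_makarLimanov_iff] at hx ⊢
  intro D hD
  rw [← Derivation.basis_repr_rTensor, hx _ hD.rTensor, map_zero, Finsupp.zero_apply]

theorem makarLimanov_tensor_le_range_includeRight [Module.Free k B]
    (hA : MakarLimanov k A = ⊥) :
    MakarLimanov k (A ⊗[k] B) ≤
      (Algebra.TensorProduct.includeRight : B →ₐ[k] A ⊗[k] B).range := by
  intro x hx
  let b := Module.Free.chooseBasis k B
  rw [← (Algebra.TensorProduct.basis A b).linearCombination_repr x,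
    Finsupp.linearCombination_apply]
  refine Subalgebra.sum_mem _ fun i _ => ?_
  have hi := basis_repr_mem_makarLimanov b hx i
  rw [hA, Algebra.mem_bot] at hi
  obtain ⟨c, hc⟩ := hi
  dsimp only
  rw [← hc, algebraMap_smul, Algebra.TensorProduct.basis_apply]
  exact Subalgebra.smul_mem _ (AlgHom.mem_range_self _ (b i)) c

theorem mem_makarLimanov_of_one_tmul_mem {k A B : Type*} [Field k] [CommRing A] [Algebra k A]
    [Nontrivial A] [CommRing B] [Algebra k B] {b : B}
    (hb : (1 : A) ⊗ₜ[k] b ∈ MakarLimanov k (A ⊗[k] B)) : b ∈ MakarLimanov k B := by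
  rw [mem_makarLimanov_iff] at hb ⊢
  intro D hD
  have h := hb _ hD.lTensor
  rw [Derivation.lTensor_tmul] at h
  refine Algebra.TensorProduct.includeRight_injective (R := k) (A := A) (B := B)
    (algebraMap k A).injective ?_
  simpa using h

end

open TensorProduct in
theorem makarLimanov_tensor_trivial (k A B : Type*) [Field k] [CharZero k]
    [CommRing A] [Algebra k A] [CommRing B] [Algebra k B]
    (hA : MakarLimanov k A = ⊥) (hB : MakarLimanov k B = ⊥) :
    MakarLimanov k (A ⊗[k] B) = ⊥ := by
  refine le_antisymm (fun x hx => ?_) bot_le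
  rcases subsingleton_or_nontrivial A with hs | hs
  · have h1 : (1 : A ⊗[k] B) = 0 := by
      rw [Algebra.TensorProduct.one_def, Subsingleton.elim (1 : A) 0, TensorProduct.zero_tmul]
    rw [← mul_one x, h1, mul_zero]
    exact zero_mem _
  · obtain ⟨b, rfl⟩ := makarLimanov_tensor_le_range_includeRight hA hx
    have hb : b ∈ MakarLimanov k B := mem_makarLimanov_of_one_tmul_mem (A := A) hx
    rw [hB, Algebra.mem_bot] at hb
    obtain ⟨c, rfl⟩ := hb
    rw [Algebra.mem_bot]
    exact ⟨c, (AlgHom.commutes _ c).symm⟩
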